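/- For all compatible positive complex structures j_a, j_b, j_c on (E, ω), the complex conjugate of ζ(j_a,j_b,j_c) equals ζ(j_c,j_b,j_a). In particular ζ(j_a,j_b,j_a) is a real number. -/

import Mathlib

open Complex

noncomputable section

variable {E : Type*} [AddCommGroup E] [Module ℝ E]

/-- `j` is a complex structure on `E`: `j ∘ j = -id`. -/
def IsCplxStruct (j : E →ₗ[ℝ] E) : Prop := ∀ x : E, j (j x) = -x

/-- `j` is compatible with the symplectic form `ω`. -/
def OmCompat (ω : E [⋀^Fin 2]→ₗ[ℝ] ℝ) (j : E →ₗ[ℝ] E) : Prop :=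
  ∀ x y : E, ω ![j x, j y] = ω ![x, y]

/-- `j` is positive with respect to `ω`. -/
def OmPos (ω : E [⋀^Fin 2]→ₗ[ℝ] ℝ) (j : E →ₗ[ℝ] E) : Prop :=
  ∀ x : E, x ≠ 0 → 0 < ω ![x, j x]

/-- `ω` is nondegenerate. -/
def OmNondeg (ω : E [⋀^Fin 2]→ₗ[ℝ] ℝ) : Prop :=
  ∀ x : E, (∀ y : E, ω ![x, y] = 0) → x = 0

/-- The complex conjugate of a `ℂ`-valued alternating form. -/
def conjAlt {p : ℕ} (α : E [⋀^Fin p]→ₗ[ℝ] ℂ) : E [⋀^Fin p]→ₗ[ℝ] ℂ :=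
  Complex.conjAe.toLinearMap.compAlternatingMap α

/-- Wedge product of `ℂ`-valued alternating forms. -/
def wedgeC {p q : ℕ} (α : E [⋀^Fin p]→ₗ[ℝ] ℂ) (β : E [⋀^Fin q]→ₗ[ℝ] ℂ) :
    E [⋀^Fin (p + q)]→ₗ[ℝ] ℂ :=
  ((LinearMap.mul' ℝ ℂ).compAlternatingMap (α.domCoprod β)).domDomCongr finSumFinEquiv

/-- The complexification of a real-valued alternating form. -/
def cplxForm {p : ℕ} (ω : E [⋀^Fin p]→ₗ[ℝ] ℝ) : E [⋀^Fin p]→ₗ[ℝ] ℂ :=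
  (Algebra.linearMap ℝ ℂ).compAlternatingMap ω

/-- `ω^{∧ m}`. -/
def omPow (ω : E [⋀^Fin 2]→ₗ[ℝ] ℝ) : (m : ℕ) → E [⋀^Fin (2 * m)]→ₗ[ℝ] ℂ
  | 0 => (AlternatingMap.constOfIsEmpty ℝ E (Fin 0) 1).domDomCongr (finCongr (by ring))
  | (m + 1) => (wedgeC (cplxForm ω) (omPow ω m)).domDomCongr (finCongr (by ring))

/-- `ω^{∧ n}`, reindexed by `Fin (n + n)`. -/
def topPow (ω : E [⋀^Fin 2]→ₗ[ℝ] ℝ) (n : ℕ) : E [⋀^Fin (n + n)]→ₗ[ℝ] ℂ :=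
  (omPow ω n).domDomCongr (finCongr (by ring))

/-- `Λ^{n,0}_j E*`: the space of `ℂ`-valued alternating `p`-forms `α` with
`α (j v₁, v₂, …, v_p) = i • α (v₁, …, v_p)`. -/
def Lam (j : E →ₗ[ℝ] E) (p : ℕ) : Submodule ℂ (E [⋀^Fin p]→ₗ[ℝ] ℂ) where
  carrier := {α | ∀ (v : Fin p → E) (i : Fin p), (i : ℕ) = 0 →
    α (Function.update v i (j (v i))) = Complex.I * α v}
  add_mem' := by
    intro a b ha hb v i hi
    simp only [AlternatingMap.add_apply, ha v i hi, hb v i hi]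
    ring
  zero_mem' := by
    intro v i hi
    simp
  smul_mem' := by
    intro c a ha v i hi
    simp only [AlternatingMap.smul_apply, ha v i hi, smul_eq_mul]
    ring

/-- The scalar `α ∧ β̄ / ω^{∧ n}`. -/
def pairing (ω : E [⋀^Fin 2]→ₗ[ℝ] ℝ) (n : ℕ) (α β : E [⋀^Fin n]→ₗ[ℝ] ℂ) : ℂ :=
  letI := Classical.propDecidable (∃ c : ℂ, wedgeC α (conjAlt β) = c • topPow ω n)
  if h : ∃ c : ℂ, wedgeC α (conjAlt β) = c • topPow ω n then h.choose else 0

/-- The defining property of `Ψ_{j_a,j_b}`. -/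
def PsiProp (ω : E [⋀^Fin 2]→ₗ[ℝ] ℝ) (n : ℕ) (ja jb : E →ₗ[ℝ] E)
    (Ψ : Lam ja n →ₗ[ℂ] Lam jb n) : Prop :=
  ∀ α β : Lam ja n,
    wedgeC ((Ψ α : E [⋀^Fin n]→ₗ[ℝ] ℂ)) (conjAlt (β : E [⋀^Fin n]→ₗ[ℝ] ℂ)) =
      wedgeC (α : E [⋀^Fin n]→ₗ[ℝ] ℂ) (conjAlt (β : E [⋀^Fin n]→ₗ[ℝ] ℂ))

/-- The form `z₁ ∧ ⋯ ∧ zₙ` attached to a family of real-linear functionals `zᵢ : E → ℂ`. -/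
def detForm {n : ℕ} (z : Fin n → E →ₗ[ℝ] ℂ) : E [⋀^Fin n]→ₗ[ℝ] ℂ :=
  MultilinearMap.alternatization ((MultilinearMap.mkPiAlgebra ℝ (Fin n) ℂ).compLinearMap z)

theorem detForm_apply {n : ℕ} (z : Fin n → E →ₗ[ℝ] ℂ) (v : Fin n → E) :
    detForm z v = (Matrix.of fun k i => z i (v k)).det := by
  simp [detForm, MultilinearMap.alternatization_apply, Matrix.det_apply]

theorem conjAlt_detForm {n : ℕ} (z : Fin n → E →ₗ[ℝ] ℂ) :
    conjAlt (detForm z) = detForm fun i => Complex.conjAe.toLinearMap ∘ₗ z i := by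
  ext v
  simp only [conjAlt, LinearMap.compAlternatingMap_apply, detForm_apply]
  exact RingHom.map_det (starRingEnd ℂ) _

theorem wedgeC_smul_left {p q : ℕ} (c : ℂ) (α : E [⋀^Fin p]→ₗ[ℝ] ℂ) (β : E [⋀^Fin q]→ₗ[ℝ] ℂ) :
    wedgeC (c • α) β = c • wedgeC α β := by
  ext v
  simp only [wedgeC, AlternatingMap.domDomCongr_apply, LinearMap.compAlternatingMap_apply,
    AlternatingMap.smul_apply, AlternatingMap.domCoprod_apply, sum_apply, map_sum,
    Finset.smul_sum]
  refine Finset.sum_congr rfl fun σ _ => ?_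
  induction σ using Quotient.inductionOn' with
  | h σ =>
    rw [AlternatingMap.domCoprod.summand_mk'', AlternatingMap.domCoprod.summand_mk'']
    obtain h | h := Int.units_eq_one_or (Equiv.Perm.sign σ) <;>
      simp [h, Units.smul_def, mul_assoc]

theorem wedgeC_detForm_apply {p q : ℕ} (z : Fin p → E →ₗ[ℝ] ℂ) (z' : Fin q → E →ₗ[ℝ] ℂ)
    (v : Fin p ⊕ Fin q → E) :
    wedgeC (detForm z) (detForm z') (v ∘ finSumFinEquiv.symm) =
      (Matrix.of fun k i => Sum.elim z z' i (v k)).det := by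
  have hv : (v ∘ finSumFinEquiv.symm) ∘ finSumFinEquiv = v := by
    ext i; simp
  simp only [wedgeC, AlternatingMap.domDomCongr_apply, LinearMap.compAlternatingMap_apply,
    detForm, ← MultilinearMap.domCoprod_alternization]
  rw [hv, MultilinearMap.alternatization_apply, Matrix.det_apply, map_sum]
  refine Finset.sum_congr rfl fun σ _ => ?_
  obtain h | h := Int.units_eq_one_or (Equiv.Perm.sign σ) <;> simp [h]

/-- The sign of the exchange of two blocks of length `n`. -/
def blockSwapSign (n : ℕ) : ℂ :=
  ((Equiv.Perm.sign (Equiv.sumComm (Fin n) (Fin n)) : ℤ) : ℂ)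

theorem blockSwapSign_mul_self (n : ℕ) : blockSwapSign n * blockSwapSign n = 1 := by
  simp [blockSwapSign, ← Int.cast_mul, ← Units.val_mul]

theorem conj_wedgeC_detForm {n : ℕ} (z z' : Fin n → E →ₗ[ℝ] ℂ) (w : Fin (n + n) → E) :
    (starRingEnd ℂ) (wedgeC (detForm z) (conjAlt (detForm z')) w) =
      blockSwapSign n * wedgeC (detForm z') (conjAlt (detForm z)) w := by
  obtain ⟨v, rfl⟩ : ∃ v : Fin n ⊕ Fin n → E, w = v ∘ finSumFinEquiv.symm :=
    ⟨w ∘ finSumFinEquiv, by ext; simp⟩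
  rw [conjAlt_detForm, conjAlt_detForm, wedgeC_detForm_apply, wedgeC_detForm_apply,
    RingHom.map_det, blockSwapSign, ← Matrix.det_permute']
  congr 1
  ext k (i | i) <;> simp

theorem wedgeC_conjAlt_detForm_ne_zero {n : ℕ} (j : E →ₗ[ℝ] E) (z : Fin n → E →ₗ[ℝ] ℂ)
    (e : Fin n → E) (hze : ∀ i k, z i (e k) = if i = k then 1 else 0)
    (hzj : ∀ i x, z i (j x) = I * z i x) :
    wedgeC (detForm z) (conjAlt (detForm z)) ≠ 0 := by
  intro h
  have h1 := DFunLike.congr_fun h (Sum.elim e (fun k => j (e k)) ∘ finSumFinEquiv.symm)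
  rw [conjAlt_detForm, wedgeC_detForm_apply] at h1
  have h2 : (Matrix.of fun k i => Sum.elim z (fun i => Complex.conjAe.toLinearMap ∘ₗ z i) i
      (Sum.elim e (fun k => j (e k)) k)) =
      Matrix.fromBlocks 1 1 (I • (1 : Matrix (Fin n) (Fin n) ℂ)) (-I • 1) := by
    ext (k | k) (i | i) <;> simp [hze, hzj, Matrix.one_apply, eq_comm, apply_ite]
  rw [h2, Matrix.det_fromBlocks_one₁₁, Matrix.mul_one, ← sub_smul, Matrix.det_smul] at h1
  have h3 : -I - I ≠ 0 := by
    intro h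
    have := congrArg Complex.im h
    norm_num at this
  simp [h3] at h1

theorem alternating_eq_zero_of_basis {n : ℕ} (w : Module.Basis (Fin n) ℝ E)
    (F : E [⋀^Fin n]→ₗ[ℝ] ℂ) (h : F w = 0) : F = 0 := by
  refine Module.Basis.ext_alternating w fun i hi => ?_
  have := F.map_perm w (Equiv.ofBijective i (Finite.injective_iff_bijective.1 hi))
  rw [h, smul_zero] at this
  exact this

theorem Lam_map_update {n : ℕ} {j : E →ₗ[ℝ] E} {α : E [⋀^Fin n]→ₗ[ℝ] ℂ} (hα : α ∈ Lam j n)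
    (v : Fin n → E) (i : Fin n) : α (Function.update v i (j (v i))) = I * α v := by
  have hn : 0 < n := i.pos
  set o : Fin n := ⟨0, hn⟩
  by_cases hi : i = o
  · exact hα v i (by simp [hi, o])
  have h1 := hα (v ∘ Equiv.swap o i) o rfl
  have h2 : Function.update (v ∘ Equiv.swap o i) o (j ((v ∘ Equiv.swap o i) o)) =
      Function.update v i (j (v i)) ∘ Equiv.swap o i := by
    rw [Function.update_comp_equiv]
    simp
  rw [h2, α.map_swap _ (Ne.symm hi), α.map_swap _ (Ne.symm hi)] at h1
  linear_combination -h1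

theorem detForm_mem_Lam {n : ℕ} {j : E →ₗ[ℝ] E} {z : Fin n → E →ₗ[ℝ] ℂ}
    (hzj : ∀ i x, z i (j x) = I * z i x) : detForm z ∈ Lam j n := by
  intro v k _
  set M : Matrix (Fin n) (Fin n) ℂ := Matrix.of fun k i => z i (v k)
  have h : (Matrix.of fun l i => z i (Function.update v k (j (v k)) l)) =
      M.updateRow k (I • M k) := by
    ext l i
    by_cases hl : l = k
    · subst hl
      simp [M, hzj]
    · simp [M, hl]
  rw [detForm_apply, detForm_apply, h, Matrix.det_updateRow_smul, Matrix.updateRow_eq_self]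

theorem exists_frame [FiniteDimensional ℝ E] {n : ℕ} (hdim : Module.finrank ℝ E = 2 * n)
    {j : E →ₗ[ℝ] E} (hj : IsCplxStruct j) :
    ∃ (z : Fin n → E →ₗ[ℝ] ℂ) (e : Fin n → E),
      (∀ i k, z i (e k) = if i = k then 1 else 0) ∧ (∀ i x, z i (j x) = I * z i x) ∧
      ∀ α ∈ Lam j n, α = α e • detForm z := by
  let φ : ℂ →ₐ[ℝ] Module.End ℝ E := Complex.liftAux j (by ext x; simpa using hj x)
  let _ : Module ℂ E := Module.compHom E φ.toRingHom
  have smul_def : ∀ (c : ℂ) (x : E), c • x = c.re • x + c.im • j x := by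
    intro c x
    change φ c x = _
    simp [φ, Complex.liftAux_apply, Module.algebraMap_end_apply]
  have : IsScalarTower ℝ ℂ E := ⟨fun r c x => by simp [smul_def, mul_smul, smul_add]⟩
  have : Module.Finite ℂ E := Module.Finite.of_restrictScalars_finite ℝ ℂ E
  have hfin : Module.finrank ℂ E = n := by
    have := Module.finrank_mul_finrank ℝ ℂ E
    rw [Complex.finrank_real_complex, hdim] at this
    omega
  have hI : ∀ x, j x = I • x := fun x => by simp [smul_def]
  let b : Module.Basis (Fin n) ℂ E := Module.finBasisOfFinrankEq ℂ E hfin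
  refine ⟨fun i => (b.coord i).restrictScalars ℝ, b, ?_, ?_, ?_⟩
  · intro i k
    simp [Finsupp.single_apply, eq_comm]
  · intro i x
    simp [hI]
  · intro α hα
    have key : ∀ (v : Fin n → E) (i : Fin n) (c : ℂ) (x : E),
        α (Function.update v i (c • x)) = c * α (Function.update v i x) := by
      intro v i c x
      have h := Lam_map_update hα (Function.update v i x) i
      simp only [Function.update_idem, Function.update_self] at h
      rw [smul_def, AlternatingMap.map_update_add, AlternatingMap.map_update_smul,
        AlternatingMap.map_update_smul, h]
      conv_rhs => rw [← Complex.re_add_im c]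
      simp only [Complex.real_smul]
      ring
    let α' : E [⋀^Fin n]→ₗ[ℂ] ℂ :=
      { toFun := α
        map_update_add' := by
          intro inst v i x y
          cases Subsingleton.elim inst (instDecidableEqFin n)
          exact α.map_update_add v i x y
        map_update_smul' := by
          intro inst v i c x
          cases Subsingleton.elim inst (instDecidableEqFin n)
          exact key v i c x
        map_eq_zero_of_eq' := α.map_eq_zero_of_eq' }
    ext v
    have h := DFunLike.congr_fun (α'.eq_smul_basis_det b) v
    rw [AlternatingMap.smul_apply, detForm_apply, ← Matrix.det_transpose]
    exact h

theorem conj_eq_of_cocycle {ε aa bb cc ab ba ac ca bc cb tab tbc tcb tba z w : ℂ}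
    (hε : ε * ε = 1) (haa : aa ≠ 0) (hbb : bb ≠ 0) (hcc : cc ≠ 0)
    (fab : tab * ba = aa) (fbc : tbc * cb = bb) (fac : z * (tab * tbc) * ca = aa)
    (fcb : tcb * bc = cc) (fba : tba * ab = bb) (fca : w * (tcb * tba) * ac = cc)
    (cbb : (starRingEnd ℂ) bb = ε * bb) (cca : (starRingEnd ℂ) ca = ε * ac)
    (cba : (starRingEnd ℂ) ba = ε * ab) (ccb : (starRingEnd ℂ) cb = ε * bc) :
    (starRingEnd ℂ) z = w := by
  have hac : ac ≠ 0 := by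
    rintro rfl
    exact hcc (by rw [← fca, mul_zero])
  have hz : z * bb * ca = ba * cb := mul_left_cancel₀ haa (by
    linear_combination (ba * cb) * fac - z * ca * (tbc * cb * fab + aa * fbc))
  have hw : w * bb * ac = bc * ab := mul_left_cancel₀ hcc (by
    linear_combination (bc * ab) * fca - w * ac * (tba * ab * fcb + cc * fba))
  have hz' := congrArg (starRingEnd ℂ) hz
  simp only [map_mul, cbb, cca, cba, ccb] at hz'
  refine mul_right_cancel₀ (mul_ne_zero hbb hac) ?_
  linear_combination hz' - hw - ((starRingEnd ℂ) z * bb * ac - ab * bc) * hε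

theorem conj_eq_of_PsiProp [FiniteDimensional ℝ E]
    (n : ℕ) (ω : E [⋀^Fin 2]→ₗ[ℝ] ℝ)
    (hdim : Module.finrank ℝ E = 2 * n)
    (ja jb jc : E →ₗ[ℝ] E)
    (hja : IsCplxStruct ja) (hjb : IsCplxStruct jb) (hjc : IsCplxStruct jc)
    (Ψab : Lam ja n →ₗ[ℂ] Lam jb n) (hΨab : PsiProp ω n ja jb Ψab)
    (Ψbc : Lam jb n →ₗ[ℂ] Lam jc n) (hΨbc : PsiProp ω n jb jc Ψbc)
    (Ψac : Lam ja n →ₗ[ℂ] Lam jc n) (hΨac : PsiProp ω n ja jc Ψac)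
    (Ψcb : Lam jc n →ₗ[ℂ] Lam jb n) (hΨcb : PsiProp ω n jc jb Ψcb)
    (Ψba : Lam jb n →ₗ[ℂ] Lam ja n) (hΨba : PsiProp ω n jb ja Ψba)
    (Ψca : Lam jc n →ₗ[ℂ] Lam ja n) (hΨca : PsiProp ω n jc ja Ψca)
    (z w : ℂ)
    (hz : Ψac = z • (Ψbc ∘ₗ Ψab))
    (hw : Ψca = w • (Ψba ∘ₗ Ψcb)) :
    (starRingEnd ℂ) z = w := by
  let v : Module.Basis (Fin (n + n)) ℝ E :=
    Module.finBasisOfFinrankEq ℝ E (hdim.trans (two_mul n))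
  have gen : ∀ {j : E →ₗ[ℝ] E}, IsCplxStruct j → ∃ (ζ : Fin n → E →ₗ[ℝ] ℂ) (θ : Lam j n),
      θ.1 = detForm ζ ∧ wedgeC θ.1 (conjAlt θ.1) v ≠ 0 ∧ ∀ α : Lam j n, ∃ t : ℂ, α = t • θ := by
    intro j hj
    obtain ⟨ζ, e, h1, h2, h3⟩ := exists_frame hdim hj
    exact ⟨ζ, ⟨detForm ζ, detForm_mem_Lam h2⟩, rfl,
      fun h => wedgeC_conjAlt_detForm_ne_zero j ζ e h1 h2 (alternating_eq_zero_of_basis v _ h),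
      fun α => ⟨α.1 e, Subtype.ext (h3 α.1 α.2)⟩⟩
  obtain ⟨ζa, θa, ha, haa, hsa⟩ := gen hja
  obtain ⟨ζb, θb, hb, hbb, hsb⟩ := gen hjb
  obtain ⟨ζc, θc, hc, hcc, hsc⟩ := gen hjc
  have psi : ∀ {j k : E →ₗ[ℝ] E} {Ψ : Lam j n →ₗ[ℂ] Lam k n} {θ : Lam j n} {η : Lam k n},
      PsiProp ω n j k Ψ → (∀ α : Lam k n, ∃ t : ℂ, α = t • η) →
      ∃ t : ℂ, Ψ θ = t • η ∧
        t * wedgeC η.1 (conjAlt θ.1) v = wedgeC θ.1 (conjAlt θ.1) v := by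
    intro j k Ψ θ η hΨ hη
    obtain ⟨t, ht⟩ := hη (Ψ θ)
    refine ⟨t, ht, ?_⟩
    rw [← hΨ θ θ, ht, Submodule.coe_smul, wedgeC_smul_left, AlternatingMap.smul_apply, smul_eq_mul]
  have comp : ∀ {k : E →ₗ[ℝ] E} {η : Lam k n} {s t : ℂ}, wedgeC η.1 (conjAlt η.1) v ≠ 0 →
      s • η = t • η → s = t := by
    intro k η s t hη h
    have h' := congrArg (fun α : Lam k n => wedgeC α.1 (conjAlt η.1) v) h
    simp only [Submodule.coe_smul, wedgeC_smul_left, AlternatingMap.smul_apply, smul_eq_mul] at h'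
    exact mul_right_cancel₀ hη h'
  obtain ⟨tab, eab, fab⟩ := psi (θ := θa) hΨab hsb
  obtain ⟨tbc, ebc, fbc⟩ := psi (θ := θb) hΨbc hsc
  obtain ⟨tac, eac, fac⟩ := psi (θ := θa) hΨac hsc
  obtain ⟨tcb, ecb, fcb⟩ := psi (θ := θc) hΨcb hsb
  obtain ⟨tba, eba, fba⟩ := psi (θ := θb) hΨba hsa
  obtain ⟨tca, eca, fca⟩ := psi (θ := θc) hΨca hsa
  have hz' : tac = z * (tab * tbc) := comp hcc (by
    rw [← eac, hz, LinearMap.smul_apply, LinearMap.comp_apply, eab, map_smul, ebc, smul_smul,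
      smul_smul, mul_assoc])
  have hw' : tca = w * (tcb * tba) := comp haa (by
    rw [← eca, hw, LinearMap.smul_apply, LinearMap.comp_apply, ecb, map_smul, eba, smul_smul,
      smul_smul, mul_assoc])
  rw [ha, hb, hc] at *
  refine conj_eq_of_cocycle (blockSwapSign_mul_self n) haa hbb hcc fab fbc (hz' ▸ fac) fcb fba
    (hw' ▸ fca) (conj_wedgeC_detForm _ _ _) (conj_wedgeC_detForm _ _ _)
    (conj_wedgeC_detForm _ _ _) (conj_wedgeC_detForm _ _ _)

/-- `conj (ζ(j_a,j_b,j_c)) = ζ(j_c,j_b,j_a)`; in particular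
`ζ(j_a,j_b,j_a)` is real. -/
theorem statement6 {E : Type*} [AddCommGroup E] [Module ℝ E] [FiniteDimensional ℝ E]
    (n : ℕ) (hn : 0 < n) (ω : E [⋀^Fin 2]→ₗ[ℝ] ℝ)
    (hdim : Module.finrank ℝ E = 2 * n) (hnd : OmNondeg ω)
    (ja jb jc : E →ₗ[ℝ] E)
    (hja : IsCplxStruct ja) (hjb : IsCplxStruct jb) (hjc : IsCplxStruct jc)
    (hca : OmCompat ω ja) (hcb : OmCompat ω jb) (hcc : OmCompat ω jc)
    (hpa : OmPos ω ja) (hpb : OmPos ω jb) (hpc : OmPos ω jc)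
    (Ψab : Lam ja n →ₗ[ℂ] Lam jb n) (hΨab : PsiProp ω n ja jb Ψab)
    (Ψbc : Lam jb n →ₗ[ℂ] Lam jc n) (hΨbc : PsiProp ω n jb jc Ψbc)
    (Ψac : Lam ja n →ₗ[ℂ] Lam jc n) (hΨac : PsiProp ω n ja jc Ψac)
    (Ψcb : Lam jc n →ₗ[ℂ] Lam jb n) (hΨcb : PsiProp ω n jc jb Ψcb)
    (Ψba : Lam jb n →ₗ[ℂ] Lam ja n) (hΨba : PsiProp ω n jb ja Ψba)
    (Ψca : Lam jc n →ₗ[ℂ] Lam ja n) (hΨca : PsiProp ω n jc ja Ψca)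
    (Ψaa : Lam ja n →ₗ[ℂ] Lam ja n) (hΨaa : PsiProp ω n ja ja Ψaa)
    (z w : ℂ)
    (hz : Ψac = z • (Ψbc ∘ₗ Ψab))
    (hw : Ψca = w • (Ψba ∘ₗ Ψcb)) :
    (starRingEnd ℂ) z = w ∧
      ∀ u : ℂ, Ψaa = u • (Ψba ∘ₗ Ψab) → u.im = 0 := by
  refine ⟨conj_eq_of_PsiProp n ω hdim ja jb jc hja hjb hjc Ψab hΨab Ψbc hΨbc Ψac hΨac Ψcb hΨcb
    Ψba hΨba Ψca hΨca z w hz hw, fun u hu => Complex.conj_eq_iff_im.1 ?_⟩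
  exact conj_eq_of_PsiProp n ω hdim ja jb ja hja hjb hja Ψab hΨab Ψba hΨba Ψaa hΨaa Ψab hΨab
    Ψba hΨba Ψaa hΨaa u u hu hu

end
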